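/- Let α be badly approximable with constant δ (0 < δ < 1), let ε > 0, and let q₀ be a positive integer. Let J ⊆ [0,1] be a dyadic interval of the form [a/2^l, (a+1)/2^l] with a an integer, where l = ⌊log₂(q²·(log₂ q)²/ε)⌋ for some integer q ≥ q₀ ≥ 2, and let x be an integer with x ≥ q³ (so that x > 2^{l+1} when q₀ is large enough). Then mes(J ∩ A(x)) ≤ (2⁴·ε/(‖αx‖·x·(log₂ x)²))·mes(J). -/

import Mathlib

open MeasureTheory

/-- Distance from a real number to the nearest integer. -/
noncomputable def nint (t : ℝ) : ℝ := |t - round t|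

/-- The "dangerous" neighbourhood `E(x)` of rationals with denominator `x`:
`E(x) = (⋃_{y=0}^{x} [y/x − ε/(‖αx‖x²log₂²x), y/x + ε/(‖αx‖x²log₂²x)]) ∩ [0,1]`. -/
noncomputable def Eset (α ε : ℝ) (x : ℕ) : Set ℝ :=
  (⋃ y ∈ Finset.range (x + 1),
      Set.Icc ((y : ℝ) / x - ε / (nint (α * x) * (x : ℝ) ^ 2 * (Real.logb 2 x) ^ 2))
              ((y : ℝ) / x + ε / (nint (α * x) * (x : ℝ) ^ 2 * (Real.logb 2 x) ^ 2)))
    ∩ Set.Icc 0 1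

/-- The dyadic scale `l_x = ⌊log₂(‖αx‖ x² log₂² x / (2ε))⌋`. -/
noncomputable def lx (α ε : ℝ) (x : ℕ) : ℤ :=
  ⌊Real.logb 2 (nint (α * x) * (x : ℝ) ^ 2 * (Real.logb 2 x) ^ 2 / (2 * ε))⌋

/-- `A(x)`: the union of all dyadic intervals of length `2^{-l_x}` at scale `l_x`
that meet `E(x)` (the smallest union of such intervals covering `E(x)`). -/
noncomputable def Aset (α ε : ℝ) (x : ℕ) : Set ℝ :=
  ⋃ a : ℤ, ⋃ _ : (Set.Icc ((a : ℝ) / (2 : ℝ) ^ lx α ε x) (((a : ℝ) + 1) / (2 : ℝ) ^ lx α ε x)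
      ∩ Eset α ε x).Nonempty,
    Set.Icc ((a : ℝ) / (2 : ℝ) ^ lx α ε x) (((a : ℝ) + 1) / (2 : ℝ) ^ lx α ε x)

/-- `A^c(x) = [0,1] \ A(x)`. -/
noncomputable def Acset (α ε : ℝ) (x : ℕ) : Set ℝ := Set.Icc 0 1 \ Aset α ε x

/-- `B_q = ⋂_{x=q₀}^{q} A^c(x)`. -/
noncomputable def Bset (α ε : ℝ) (q₀ q : ℕ) : Set ℝ := ⋂ x ∈ Finset.Icc q₀ q, Acset α ε x

open Filter

/-- A set within distance `ρ` of the lattice `ℤ / X` meets an interval of length `H` in measure at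
most `(X * (H + 2 * ρ) + 1) * (2 * ρ)`. -/
lemma volume_Icc_inter_le_of_near_lattice {X u H ρ : ℝ} (hX : 0 < X) (hH : 0 ≤ H) (hρ : 0 ≤ ρ)
    {A : Set ℝ} (hA : ∀ t ∈ A, ∃ y : ℤ, |t - y / X| ≤ ρ) :
    volume (Set.Icc u (u + H) ∩ A) ≤ ENNReal.ofReal ((X * (H + 2 * ρ) + 1) * (2 * ρ)) := by
  set S : Finset ℤ := Finset.Icc ⌈X * (u - ρ)⌉ ⌊X * (u + H + ρ)⌋ with hS
  have hcover : Set.Icc u (u + H) ∩ A ⊆ ⋃ y ∈ S, Set.Icc ((y : ℝ) / X - ρ) (y / X + ρ) := by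
    rintro t ⟨⟨hut, htu⟩, ht⟩
    obtain ⟨y, hy⟩ := hA t ht
    obtain ⟨h₁, h₂⟩ := abs_le.mp hy
    refine Set.mem_iUnion₂.mpr ⟨y, ?_, by linarith, by linarith⟩
    have hyX : (y : ℝ) = X * (y / X) := by field_simp
    rw [hS, Finset.mem_Icc, Int.ceil_le, Int.le_floor, hyX]
    constructor <;> gcongr <;> linarith
  have hcard : (S.card : ℝ) ≤ X * (H + 2 * ρ) + 1 := by
    have hpos : 0 ≤ X * (H + 2 * ρ) := by positivity
    have hcast : (S.card : ℝ) = ((S.card : ℤ) : ℝ) := by norm_cast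
    rw [hcast, hS, Int.card_Icc, Int.toNat_eq_max]
    push_cast
    refine max_le ?_ (by linarith)
    have h₁ := Int.floor_le (X * (u + H + ρ))
    have h₂ := Int.le_ceil (X * (u - ρ))
    nlinarith
  calc volume (Set.Icc u (u + H) ∩ A)
      ≤ volume (⋃ y ∈ S, Set.Icc ((y : ℝ) / X - ρ) (y / X + ρ)) := measure_mono hcover
    _ ≤ ∑ y ∈ S, volume (Set.Icc ((y : ℝ) / X - ρ) (y / X + ρ)) := measure_biUnion_finset_le _ _
    _ = ∑ _y ∈ S, ENNReal.ofReal (2 * ρ) := by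
        refine Finset.sum_congr rfl fun y _ => ?_
        rw [Real.volume_Icc]
        congr 1
        ring
    _ = ENNReal.ofReal (S.card * (2 * ρ)) := by
        rw [Finset.sum_const, nsmul_eq_mul, ENNReal.ofReal_mul (Nat.cast_nonneg _),
          ENNReal.ofReal_natCast]
    _ ≤ _ := by gcongr

/-- For `z > 0`, the dyadic length `2 ^ (-⌊log₂ z⌋)` is less than `2 / z`. -/
lemma inv_two_zpow_floor_logb_lt {z : ℝ} (hz : 0 < z) :
    ((2 : ℝ) ^ ⌊Real.logb 2 z⌋)⁻¹ < 2 / z := by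
  have h := Int.lt_floor_add_one (Real.logb 2 z)
  rw [Real.logb_lt_iff_lt_rpow one_lt_two hz, Real.rpow_add two_pos, Real.rpow_one,
    Real.rpow_intCast] at h
  rw [inv_lt_comm₀ (by positivity) (by positivity), inv_div]
  linarith

/-- For `z > 0`, the dyadic length `2 ^ (-⌊log₂ z⌋)` is at least `1 / z`. -/
lemma inv_le_inv_two_zpow_floor_logb {z : ℝ} (hz : 0 < z) :
    z⁻¹ ≤ ((2 : ℝ) ^ ⌊Real.logb 2 z⌋)⁻¹ := by
  have h := Int.floor_le (Real.logb 2 z)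
  rw [Real.le_logb_iff_rpow_le one_lt_two hz, Real.rpow_intCast] at h
  gcongr

/-- Every point of `A(x)` lies within five radii of the lattice `ℤ / x`. -/
lemma exists_abs_sub_div_le_of_mem_Aset {α ε : ℝ} {x : ℕ} (hε : 0 < ε)
    (hN : 0 < nint (α * x) * (x : ℝ) ^ 2 * (Real.logb 2 x) ^ 2) {t : ℝ} (ht : t ∈ Aset α ε x) :
    ∃ y : ℤ, |t - y / (x : ℝ)| ≤
      5 * (ε / (nint (α * x) * (x : ℝ) ^ 2 * (Real.logb 2 x) ^ 2)) := by
  obtain ⟨b, ⟨s, ⟨hs₁, hs₂⟩, hsE⟩, ht₁, ht₂⟩ := Set.mem_iUnion₂.mp ht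
  obtain ⟨y, -, hy₁, hy₂⟩ := Set.mem_iUnion₂.mp hsE.1
  have hlen := inv_two_zpow_floor_logb_lt (z := nint (α * x) * (x : ℝ) ^ 2 *
    (Real.logb 2 x) ^ 2 / (2 * ε)) (by positivity)
  rw [← lx] at hlen
  set N := nint (α * x) * (x : ℝ) ^ 2 * (Real.logb 2 x) ^ 2
  have hr : 2 / (N / (2 * ε)) = 4 * (ε / N) := by field_simp; norm_num
  rw [add_div, one_div] at hs₂ ht₂
  refine ⟨y, abs_le.mpr ⟨?_, ?_⟩⟩ <;> push_cast <;> linarith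

lemma tendsto_div_logb_sq_atTop :
    Tendsto (fun q : ℕ => (q : ℝ) / (Real.logb 2 q) ^ 2) atTop atTop := by
  have hlog : (fun t : ℝ => (Real.logb 2 t) ^ 2) =o[atTop] (id : ℝ → ℝ) := by
    have h := (Real.isLittleO_pow_log_id_atTop (n := 2)).const_mul_left ((Real.log 2 ^ 2)⁻¹)
    refine h.congr_left fun t => ?_
    rw [Real.logb, div_pow, div_eq_inv_mul]
  have hzero := hlog.tendsto_div_nhds_zero
  have hpos : ∀ᶠ t : ℝ in atTop, (Real.logb 2 t) ^ 2 / id t ∈ Set.Ioi (0 : ℝ) := by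
    filter_upwards [eventually_gt_atTop 1] with t ht
    have := Real.logb_pos one_lt_two ht
    have ht0 : 0 < t := by linarith
    rw [Set.mem_Ioi, id_eq]
    positivity
  have h := (tendsto_nhdsWithin_iff.mpr ⟨hzero, hpos⟩).inv_tendsto_nhdsGT_zero
  refine (h.comp tendsto_natCast_atTop_atTop).congr fun q => ?_
  simp

theorem dyadic_interval_intersect_Aset_bound
    (α δ : ℝ) (hδ0 : 0 < δ) (hδ1 : δ < 1)
    (hbad : ∀ n : ℕ, 0 < n → δ ≤ (n : ℝ) * nint (α * n))
    (ε : ℝ) (hε : 0 < ε) :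
    ∃ Q₀ : ℕ, 2 ≤ Q₀ ∧ ∀ q₀ : ℕ, Q₀ ≤ q₀ → ∀ q : ℕ, q₀ ≤ q →
      ∀ l : ℤ, l = ⌊Real.logb 2 ((q : ℝ) ^ 2 * (Real.logb 2 q) ^ 2 / ε)⌋ →
      ∀ x : ℕ, q ^ 3 ≤ x →
      ∀ a : ℤ, ∀ J : Set ℝ,
        J = Set.Icc ((a : ℝ) / (2 : ℝ) ^ l) (((a : ℝ) + 1) / (2 : ℝ) ^ l) →
        J ⊆ Set.Icc 0 1 →
        volume (J ∩ Aset α ε x)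
          ≤ ENNReal.ofReal (2 ^ 4 * ε / (nint (α * x) * (x : ℝ) * (Real.logb 2 x) ^ 2))
            * volume J := by
  obtain ⟨Q, hQ⟩ := eventually_atTop.mp
    (tendsto_div_logb_sq_atTop.eventually_ge_atTop (17 / δ + 2 / ε))
  refine ⟨max Q 2, le_max_right _ _, ?_⟩
  rintro q₀ hq₀ q hq l rfl x hx a J rfl -
  have hq2 : 2 ≤ q := (le_max_right Q 2).trans (hq₀.trans hq)
  have hqlarge := hQ q ((le_max_left Q 2).trans (hq₀.trans hq))
  have hx2 : 2 ≤ x := by nlinarith [Nat.pow_le_pow_left hq2 3]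
  have hqR : (2 : ℝ) ≤ q := by exact_mod_cast hq2
  have hxR : (2 : ℝ) ≤ x := by exact_mod_cast hx2
  have hx0 : (0 : ℝ) < x := by linarith
  have hqx : (q : ℝ) ^ 3 ≤ x := by exact_mod_cast hx
  have hLq : 0 < Real.logb 2 q := Real.logb_pos one_lt_two (by linarith)
  have hLx : 1 ≤ Real.logb 2 x := by
    rw [Real.le_logb_iff_rpow_le one_lt_two hx0]
    simpa using hxR
  have hδx : δ ≤ x * nint (α * x) := hbad x (by omega)
  have hn : 0 < nint (α * x) := by
    by_contra! h
    nlinarith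
  have hN : 0 < nint (α * x) * (x : ℝ) ^ 2 * (Real.logb 2 x) ^ 2 := by positivity
  have hH := inv_le_inv_two_zpow_floor_logb
    (z := (q : ℝ) ^ 2 * (Real.logb 2 q) ^ 2 / ε) (by positivity)
  set H := ((2 : ℝ) ^ ⌊Real.logb 2 ((q : ℝ) ^ 2 * (Real.logb 2 q) ^ 2 / ε)⌋)⁻¹ with hHdef
  have hH0 : 0 < H := by positivity
  have hvol := volume_Icc_inter_le_of_near_lattice (u := a * H) hx0 hH0.le (by positivity)
    fun t ht => exists_abs_sub_div_le_of_mem_Aset hε hN ht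
  set r := ε / (nint (α * x) * (x : ℝ) ^ 2 * (Real.logb 2 x) ^ 2) with hr
  have hr0 : 0 < r := by positivity
  have hxr : x * r ≤ ε / δ := by
    rw [hr, ← mul_div_assoc, div_le_div_iff₀ hN hδ0]
    have hL2 : 1 ≤ Real.logb 2 x ^ 2 := one_le_pow₀ hLx
    have hδL : δ ≤ x * nint (α * x) * Real.logb 2 x ^ 2 := by nlinarith
    nlinarith [mul_le_mul_of_nonneg_left hδL (mul_pos hx0 hε).le]
  have hxH : 17 * (ε / δ) + 2 ≤ x * H := by
    calc 17 * (ε / δ) + 2 = ε * (17 / δ + 2 / ε) := by field_simp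
      _ ≤ ε * (q / (Real.logb 2 q) ^ 2) := by gcongr
      _ = (q : ℝ) ^ 3 * ((q : ℝ) ^ 2 * (Real.logb 2 q) ^ 2 / ε)⁻¹ := by field_simp
      _ ≤ x * H := by gcongr
  have hleft : (a : ℝ) / (2 : ℝ) ^ ⌊Real.logb 2 ((q : ℝ) ^ 2 * (Real.logb 2 q) ^ 2 / ε)⌋
      = a * H := div_eq_mul_inv _ _
  have hright : ((a : ℝ) + 1) / (2 : ℝ) ^ ⌊Real.logb 2 ((q : ℝ) ^ 2 * (Real.logb 2 q) ^ 2 / ε)⌋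
      = a * H + H := by rw [div_eq_mul_inv, ← hHdef]; ring
  have hcoef : 2 ^ 4 * ε / (nint (α * x) * (x : ℝ) * (Real.logb 2 x) ^ 2) = 16 * r * x := by
    rw [hr]
    field_simp
    norm_num
  rw [hleft, hright, hcoef, Real.volume_Icc, add_sub_cancel_left,
    ← ENNReal.ofReal_mul (by positivity)]
  refine hvol.trans (ENNReal.ofReal_le_ofReal ?_)
  have hcount : 10 * (x * (H + 2 * (5 * r)) + 1) ≤ 16 * (x * H) := by
    linarith [div_pos hε hδ0]
  nlinarith [mul_le_mul_of_nonneg_right hcount hr0.le]
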